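/- For all real z > ν ≥ 0, (π/2)·M²(ν,z) ≤ 1/√(z² − ν²). -/

import Mathlib

open Real MeasureTheory Set Filter

/-- Integral representation of the modified Bessel function `K₀`. -/
noncomputable def K0 (x : ℝ) : ℝ := ∫ t in Ioi (0:ℝ), Real.exp (-x * Real.cosh t)

/-- Bessel modulus squared, via Nicholson's formula. -/
noncomputable def M2 (ν z : ℝ) : ℝ :=
  (8 / π ^ 2) * ∫ t in Ioi (0:ℝ), K0 (2 * z * Real.sinh t) * Real.cosh (2 * ν * t)

theorem integrableOn_exp_neg_mul_cosh {x : ℝ} (hx : 0 < x) :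
    IntegrableOn (fun t => Real.exp (-x * Real.cosh t)) (Ioi 0) := by
  refine (exp_neg_integrableOn_Ioi 0 hx).mono' (by fun_prop) (Eventually.of_forall fun t => ?_)
  rw [Real.norm_eq_abs, abs_of_nonneg (Real.exp_nonneg _)]
  apply Real.exp_le_exp.mpr
  have : t ≤ Real.cosh t := by
    rcases le_total t 0 with h | h
    · exact h.trans (Real.cosh_pos t).le
    · exact (Real.self_le_sinh_iff.mpr h).trans (Real.sinh_lt_cosh t).le
  nlinarith

theorem K0_nonneg (x : ℝ) : 0 ≤ K0 x := integral_nonneg fun _ => Real.exp_nonneg _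

theorem K0_le_K0 {x y : ℝ} (hx : 0 < x) (hxy : x ≤ y) : K0 y ≤ K0 x := by
  refine integral_mono_of_nonneg (Eventually.of_forall fun _ => Real.exp_nonneg _)
    (integrableOn_exp_neg_mul_cosh hx) (Eventually.of_forall fun t => ?_)
  apply Real.exp_le_exp.mpr
  nlinarith [Real.cosh_pos t]

theorem exp_neg_mul_mul_cosh_eq (c b t : ℝ) :
    Real.exp (-c * t) * Real.cosh (b * t) =
      (Real.exp (-(c - b) * t) + Real.exp (-(c + b) * t)) / 2 := by
  rw [Real.cosh_eq, mul_div_assoc', mul_add, ← Real.exp_add, ← Real.exp_add]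
  ring_nf

theorem integrableOn_exp_neg_mul_mul_cosh {b c : ℝ} (hb : 0 ≤ b) (hbc : b < c) :
    IntegrableOn (fun t => Real.exp (-c * t) * Real.cosh (b * t)) (Ioi 0) := by
  simp only [exp_neg_mul_mul_cosh_eq]
  exact ((exp_neg_integrableOn_Ioi 0 (sub_pos.mpr hbc)).add
    (exp_neg_integrableOn_Ioi 0 (by linarith : 0 < c + b))).div_const 2

theorem integral_exp_neg_mul_mul_cosh {b c : ℝ} (hb : 0 ≤ b) (hbc : b < c) :
    ∫ t in Ioi (0 : ℝ), Real.exp (-c * t) * Real.cosh (b * t) = c / (c ^ 2 - b ^ 2) := by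
  have h₁ : 0 < c - b := sub_pos.mpr hbc
  have h₂ : 0 < c + b := by linarith
  simp only [exp_neg_mul_mul_cosh_eq]
  rw [integral_div, integral_add (exp_neg_integrableOn_Ioi 0 h₁) (exp_neg_integrableOn_Ioi 0 h₂),
    integral_exp_mul_Ioi (by linarith), integral_exp_mul_Ioi (by linarith)]
  have h₃ : c ^ 2 - b ^ 2 = (c - b) * (c + b) := by ring
  rw [h₃]
  simp only [mul_zero, Real.exp_zero, neg_div_neg_eq]
  field_simp
  ring

theorem hasDerivAt_arctan_mul_sinh {a b : ℝ} (hb : 0 ≤ b) (hab : b < a) (s : ℝ) :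
    HasDerivAt (fun s => Real.arctan (a / √(a ^ 2 - b ^ 2) * Real.sinh s) / √(a ^ 2 - b ^ 2))
      (a * Real.cosh s / ((a * Real.cosh s) ^ 2 - b ^ 2)) s := by
  have hd : 0 < a ^ 2 - b ^ 2 := by nlinarith
  have hr : 0 < √(a ^ 2 - b ^ 2) := Real.sqrt_pos.mpr hd
  have hr2 : √(a ^ 2 - b ^ 2) ^ 2 = a ^ 2 - b ^ 2 := Real.sq_sqrt hd.le
  refine ((((Real.hasDerivAt_sinh s).const_mul (a / √(a ^ 2 - b ^ 2))).arctan).div_const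
    (√(a ^ 2 - b ^ 2))).congr_deriv ?_
  set r := √(a ^ 2 - b ^ 2)
  have h₁ : (a * Real.cosh s) ^ 2 - b ^ 2 = r ^ 2 + (a * Real.sinh s) ^ 2 := by
    rw [hr2, mul_pow, Real.cosh_sq]; ring
  have h₂ : 0 < r ^ 2 + (a * Real.sinh s) ^ 2 := by positivity
  have h₃ : 1 + (a / r * Real.sinh s) ^ 2 = (r ^ 2 + (a * Real.sinh s) ^ 2) / r ^ 2 := by
    field_simp
  rw [h₁, h₃]
  field_simp

theorem tendsto_arctan_mul_sinh {a b : ℝ} (hb : 0 ≤ b) (hab : b < a) :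
    Tendsto (fun s => Real.arctan (a / √(a ^ 2 - b ^ 2) * Real.sinh s) / √(a ^ 2 - b ^ 2)) atTop
      (nhds (π / 2 / √(a ^ 2 - b ^ 2))) := by
  have hd : 0 < a ^ 2 - b ^ 2 := by nlinarith
  have ha : 0 < a / √(a ^ 2 - b ^ 2) := div_pos (by linarith) (Real.sqrt_pos.mpr hd)
  have hs : Tendsto Real.sinh atTop atTop := Real.sinhOrderIso.tendsto_atTop
  exact (((Real.tendsto_arctan_atTop.mono_right nhdsWithin_le_nhds).comp
    (hs.const_mul_atTop ha))).div_const _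

theorem div_cosh_sq_sub_nonneg {a b : ℝ} (hb : 0 ≤ b) (hab : b < a) (s : ℝ) :
    0 ≤ a * Real.cosh s / ((a * Real.cosh s) ^ 2 - b ^ 2) := by
  have h : b < a * Real.cosh s := by nlinarith [Real.one_le_cosh s]
  exact div_nonneg (by linarith) (by nlinarith)

theorem integrableOn_div_cosh_sq_sub {a b : ℝ} (hb : 0 ≤ b) (hab : b < a) :
    IntegrableOn (fun s => a * Real.cosh s / ((a * Real.cosh s) ^ 2 - b ^ 2)) (Ioi 0) :=
  integrableOn_Ioi_deriv_of_nonneg' (fun s _ => hasDerivAt_arctan_mul_sinh hb hab s)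
    (fun s _ => div_cosh_sq_sub_nonneg hb hab s) (tendsto_arctan_mul_sinh hb hab)

theorem integral_div_cosh_sq_sub {a b : ℝ} (hb : 0 ≤ b) (hab : b < a) :
    ∫ s in Ioi (0 : ℝ), a * Real.cosh s / ((a * Real.cosh s) ^ 2 - b ^ 2) =
      π / 2 / √(a ^ 2 - b ^ 2) := by
  rw [integral_Ioi_of_hasDerivAt_of_nonneg' (fun s _ => hasDerivAt_arctan_mul_sinh hb hab s)
    (fun s _ => div_cosh_sq_sub_nonneg hb hab s) (tendsto_arctan_mul_sinh hb hab)]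
  simp

theorem integrable_exp_neg_mul_cosh_mul_cosh {a b : ℝ} (hb : 0 ≤ b) (hab : b < a) :
    Integrable (fun p : ℝ × ℝ => Real.exp (-(a * p.1) * Real.cosh p.2) * Real.cosh (b * p.1))
      ((volume.restrict (Ioi 0)).prod (volume.restrict (Ioi 0))) := by
  have hc (s : ℝ) : b < a * Real.cosh s := by nlinarith [Real.one_le_cosh s]
  have he (s t : ℝ) : -(a * t) * Real.cosh s = -(a * Real.cosh s) * t := by ring
  rw [integrable_prod_iff' (Continuous.aestronglyMeasurable (by fun_prop))]
  refine ⟨Eventually.of_forall fun s => ?_, ?_⟩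
  · simp only [he]
    exact integrableOn_exp_neg_mul_mul_cosh hb (hc s)
  · refine (integrableOn_div_cosh_sq_sub hb hab).congr (Eventually.of_forall fun s => ?_)
    simp only [he, norm_mul, Real.norm_eq_abs, Real.abs_exp, abs_of_pos (Real.cosh_pos _)]
    exact (integral_exp_neg_mul_mul_cosh hb (hc s)).symm

theorem integrableOn_K0_mul_cosh {a b : ℝ} (hb : 0 ≤ b) (hab : b < a) :
    IntegrableOn (fun t => K0 (a * t) * Real.cosh (b * t)) (Ioi 0) := by
  have h := (integrable_exp_neg_mul_cosh_mul_cosh hb hab).integral_prod_left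
  simp only [integral_mul_const] at h
  exact h

theorem integral_K0_mul_cosh {a b : ℝ} (hb : 0 ≤ b) (hab : b < a) :
    ∫ t in Ioi (0 : ℝ), K0 (a * t) * Real.cosh (b * t) = π / 2 / √(a ^ 2 - b ^ 2) := by
  have hc (s : ℝ) : b < a * Real.cosh s := by nlinarith [Real.one_le_cosh s]
  have he (s t : ℝ) : -(a * t) * Real.cosh s = -(a * Real.cosh s) * t := by ring
  have h := integral_integral_swap
    (f := fun t s => Real.exp (-(a * t) * Real.cosh s) * Real.cosh (b * t))
    (integrable_exp_neg_mul_cosh_mul_cosh hb hab)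
  rw [← integral_div_cosh_sq_sub hb hab]
  simp only [integral_mul_const] at h
  refine h.trans (integral_congr_ae (Eventually.of_forall fun s => ?_))
  simp only [he]
  exact integral_exp_neg_mul_mul_cosh hb (hc s)

/-- For all `z > ν ≥ 0`, `(π/2)·M²(ν,z) ≤ 1/√(z² − ν²)`. -/
theorem pi_div_two_mul_M2_le (z ν : ℝ) (hν : 0 ≤ ν) (hz : ν < z) :
    (π / 2) * M2 ν z ≤ 1 / Real.sqrt (z ^ 2 - ν ^ 2) := by
  have hb : 0 ≤ 2 * ν := by linarith
  have hab : 2 * ν < 2 * z := by linarith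
  have hle : ∫ t in Ioi (0 : ℝ), K0 (2 * z * Real.sinh t) * Real.cosh (2 * ν * t) ≤
      π / 2 / √((2 * z) ^ 2 - (2 * ν) ^ 2) := by
    rw [← integral_K0_mul_cosh hb hab]
    refine integral_mono_of_nonneg
      (Eventually.of_forall fun t => mul_nonneg (K0_nonneg _) (Real.cosh_pos _).le)
      (integrableOn_K0_mul_cosh hb hab) ?_
    filter_upwards [ae_restrict_mem measurableSet_Ioi] with t ht
    have ht : 0 < t := ht
    have hz0 : 0 < 2 * z := by linarith
    have hst : t ≤ Real.sinh t := Real.self_le_sinh_iff.mpr ht.le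
    gcongr
    exact K0_le_K0 (by positivity) (by gcongr)
  have hr : √((2 * z) ^ 2 - (2 * ν) ^ 2) = 2 * √(z ^ 2 - ν ^ 2) := by
    rw [show (2 * z) ^ 2 - (2 * ν) ^ 2 = 2 ^ 2 * (z ^ 2 - ν ^ 2) by ring,
      Real.sqrt_mul (by norm_num), Real.sqrt_sq (by norm_num)]
  have hpos : 0 < √(z ^ 2 - ν ^ 2) := Real.sqrt_pos.mpr (by nlinarith)
  rw [hr] at hle
  calc (π / 2) * M2 ν z ≤ (π / 2) * ((8 / π ^ 2) * (π / 2 / (2 * √(z ^ 2 - ν ^ 2)))) := by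
        unfold M2
        gcongr
    _ = 1 / √(z ^ 2 - ν ^ 2) := by
        field_simp
        norm_num
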